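/- arXiv:2012.08391 — 8 statements merged into one kernel-verified Lean document; each statement's English description precedes it below -/
import Mathlib

section
/- Suppose f₀ is continuous and positive at a point γ, f₁ is continuous at γ, and g : ℝ → ℝ satisfies g(φ_F(s)) = φ_D(s) for all s in some neighborhood of γ. Then g is differentiable at the point φ_F(γ) and its derivative there equals the likelihood ratio f₁(γ)/f₀(γ). (Equation (6): the slope of the SVT ROC curve at the operating point with threshold γ equals the likelihood ratio evaluated at γ.) -/
open MeasureTheory

/-- The upper-tail integral of an integrable function is strictly differentiable at every point of
continuity of the integrand, with derivative `-f a`. -/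
theorem hasStrictDerivAt_integral_Ioi {f : ℝ → ℝ} {a : ℝ} (hf : Integrable f)
    (ha : ContinuousAt f a) :
    HasStrictDerivAt (fun s => ∫ t in Set.Ioi s, f t) (-f a) a := by
  have hftc : HasStrictDerivAt (fun s => ∫ t in a..s, f t) (f a) a :=
    intervalIntegral.integral_hasStrictDerivAt_right hf.intervalIntegrable
      ⟨Set.univ, Filter.univ_mem, hf.aestronglyMeasurable.restrict⟩ ha
  refine (hftc.const_sub (∫ t in Set.Ioi a, f t)).congr_of_eventuallyEq
    (Filter.Eventually.of_forall fun s => ?_)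
  linarith [intervalIntegral.integral_interval_add_Ioi (hf.integrableOn (s := Set.Ioi a))
    (hf.integrableOn (s := Set.Ioi s))]

/-- Equation (6): the slope of the SVT ROC curve at the operating point with
threshold `γ` equals the likelihood ratio `f₁ γ / f₀ γ`. -/
theorem svt_roc_slope_eq_likelihood_ratio
    (f₀ f₁ : ℝ → ℝ)
    (hf₀_nonneg : ∀ s, 0 ≤ f₀ s) (hf₁_nonneg : ∀ s, 0 ≤ f₁ s)
    (hf₀_int : Integrable f₀) (hf₁_int : Integrable f₁)
    (hf₀_one : ∫ s, f₀ s = 1) (hf₁_one : ∫ s, f₁ s = 1)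
    (γ : ℝ)
    (hf₀_cont : ContinuousAt f₀ γ) (hf₀_pos : 0 < f₀ γ)
    (hf₁_cont : ContinuousAt f₁ γ)
    (g : ℝ → ℝ)
    (hg : ∀ᶠ s in nhds γ, g (∫ t in Set.Ioi s, f₀ t) = ∫ t in Set.Ioi s, f₁ t) :
    HasDerivAt g (f₁ γ / f₀ γ) (∫ t in Set.Ioi γ, f₀ t) := by
  have hF := hasStrictDerivAt_integral_Ioi hf₀_int hf₀_cont
  have hD := hasStrictDerivAt_integral_Ioi hf₁_int hf₁_cont
  have hne : -f₀ γ ≠ 0 := neg_ne_zero.mpr hf₀_pos.ne'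
  set inv := hF.localInverse _ _ _ hne
  have hinv : HasStrictDerivAt inv (-f₀ γ)⁻¹ (∫ t in Set.Ioi γ, f₀ t) := hF.to_localInverse hne
  have hinv_pt : inv (∫ t in Set.Ioi γ, f₀ t) = γ := (hF.hasStrictFDerivAt_equiv hne).localInverse_apply_image
  have hright : ∀ᶠ y in nhds (∫ t in Set.Ioi γ, f₀ t), ∫ t in Set.Ioi (inv y), f₀ t = y :=
    hF.eventually_right_inverse hne
  have hcomp : HasDerivAt (fun y => ∫ t in Set.Ioi (inv y), f₁ t) (-f₁ γ * (-f₀ γ)⁻¹)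
      (∫ t in Set.Ioi γ, f₀ t) :=
    HasDerivAt.comp_of_eq _ hD.hasDerivAt hinv.hasDerivAt hinv_pt.symm
  have htendsto : Filter.Tendsto inv (nhds (∫ t in Set.Ioi γ, f₀ t)) (nhds γ) := by
    simpa only [hinv_pt] using hinv.hasDerivAt.continuousAt.tendsto
  have hslope : -f₁ γ * (-f₀ γ)⁻¹ = f₁ γ / f₀ γ := by
    rw [← div_eq_mul_inv, neg_div_neg_eq]
  rw [← hslope]
  refine hcomp.congr_of_eventuallyEq ?_
  filter_upwards [hright, htendsto.eventually hg] with y hy hgy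
  rwa [hy] at hgy
end

section
/- Suppose f₀ is continuous and strictly positive on ℝ, f₁ is continuous, and g : ℝ → ℝ is a differentiable function with g(φ_F(s)) = φ_D(s) for all s ∈ ℝ (g is the SVT ROC curve as a function of the false-alarm probability). If g is strictly concave on (0,1), then the likelihood ratio s ↦ f₁(s)/f₀(s) is strictly increasing on ℝ (in particular it is an invertible function of the score variable). -/
open MeasureTheory

theorem hasDerivAt_integral_Ioi_of_continuous {f : ℝ → ℝ} (hf : Integrable f)
    (hc : Continuous f) (s : ℝ) :
    HasDerivAt (fun u => ∫ t in Set.Ioi u, f t) (-f s) s := by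
  have h : (fun u => ∫ t in Set.Ioi u, f t) =
      fun u => (∫ t in Set.Ioi 0, f t) - ∫ t in (0 : ℝ)..u, f t := by
    funext u
    rw [← intervalIntegral.integral_Ioi_sub_Ioi' hf.integrableOn hf.integrableOn, sub_sub_cancel]
  rw [h]
  exact (intervalIntegral.integral_hasDerivAt_right (hc.intervalIntegrable 0 s)
    hc.stronglyMeasurable.stronglyMeasurableAtFilter hc.continuousAt).const_sub _

theorem strictAnti_integral_Ioi_of_pos {f : ℝ → ℝ} (hf : Integrable f) (hpos : ∀ s, 0 < f s) :
    StrictAnti fun u => ∫ t in Set.Ioi u, f t := by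
  intro a b hab
  have h := intervalIntegral.intervalIntegral_pos_of_pos (hf.intervalIntegrable) hpos hab
  rw [← intervalIntegral.integral_Ioi_sub_Ioi hf.integrableOn hab.le] at h
  exact sub_pos.mp h

theorem integral_Ioi_mem_Ioo_of_pos {f : ℝ → ℝ} (hf : Integrable f) (hpos : ∀ s, 0 < f s)
    (s : ℝ) : ∫ t in Set.Ioi s, f t ∈ Set.Ioo 0 (∫ t, f t) := by
  have hanti := strictAnti_integral_Ioi_of_pos hf hpos
  constructor
  · exact (setIntegral_nonneg measurableSet_Ioi fun t _ => (hpos t).le).trans_lt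
      (hanti (lt_add_one s))
  · exact (hanti (sub_one_lt s)).trans_le
      (setIntegral_le_integral hf (Filter.Eventually.of_forall fun t => (hpos t).le))

/-- If the SVT ROC curve `g` (with `g (φ_F s) = φ_D s` for all `s`) is
strictly concave on `(0,1)`, then the likelihood ratio `s ↦ f₁ s / f₀ s`
is strictly increasing on ℝ. -/
theorem strictConcave_svt_roc_implies_likelihood_ratio_strictMono
    (f₀ f₁ : ℝ → ℝ)
    (hf₀_nonneg : ∀ s, 0 ≤ f₀ s) (hf₁_nonneg : ∀ s, 0 ≤ f₁ s)
    (hf₀_int : Integrable f₀) (hf₁_int : Integrable f₁)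
    (hf₀_one : ∫ s, f₀ s = 1) (hf₁_one : ∫ s, f₁ s = 1)
    (hf₀_cont : Continuous f₀) (hf₀_pos : ∀ s, 0 < f₀ s)
    (hf₁_cont : Continuous f₁)
    (g : ℝ → ℝ) (hg_diff : Differentiable ℝ g)
    (hg : ∀ s, g (∫ t in Set.Ioi s, f₀ t) = ∫ t in Set.Ioi s, f₁ t)
    (hg_concave : StrictConcaveOn ℝ (Set.Ioo 0 1) g) :
    StrictMono (fun s => f₁ s / f₀ s) := by
  have hderiv : ∀ s, f₁ s / f₀ s = deriv g (∫ t in Set.Ioi s, f₀ t) := by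
    intro s
    have hcomp := (hg_diff _).hasDerivAt.comp s
      (hasDerivAt_integral_Ioi_of_continuous hf₀_int hf₀_cont s)
    have hcomp' : HasDerivAt (g ∘ fun u => ∫ t in Set.Ioi u, f₀ t) (-f₁ s) s := by
      rw [show (g ∘ fun u => ∫ t in Set.Ioi u, f₀ t) = fun u => ∫ t in Set.Ioi u, f₁ t from
        funext hg]
      exact hasDerivAt_integral_Ioi_of_continuous hf₁_int hf₁_cont s
    rw [div_eq_iff (hf₀_pos s).ne']
    linarith [hcomp.unique hcomp']
  have hmem : ∀ s, ∫ t in Set.Ioi s, f₀ t ∈ Set.Ioo (0 : ℝ) 1 := fun s =>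
    hf₀_one ▸ integral_Ioi_mem_Ioo_of_pos hf₀_int hf₀_pos s
  intro a b hab
  simp only [hderiv]
  exact hg_concave.strictAntiOn_deriv (fun x _ => hg_diff x) (hmem b) (hmem a)
    (strictAnti_integral_Ioi_of_pos hf₀_int hf₀_pos hab)
end

section
/- (Main result: concavity of an SVT ROC curve is sufficient for Neyman-Pearson optimality.) Suppose f₀ is continuous and strictly positive on ℝ, f₁ is continuous, and g : ℝ → ℝ is a differentiable function with g(φ_F(s)) = φ_D(s) for all s ∈ ℝ, and g is strictly concave on (0,1). Then every SVT is Neyman-Pearson optimal: for every threshold γ ∈ ℝ and every Lebesgue-measurable set D ⊆ ℝ, if ∫_D f₀(s) ds ≤ φ_F(γ) then ∫_D f₁(s) ds ≤ φ_D(γ). -/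
open MeasureTheory

/-- **Neyman-Pearson lemma**: a region that contains the points where the likelihood ratio exceeds
`k` and avoids those where it is below `k` is optimal among regions of no larger false-alarm
probability. -/
theorem setIntegral_le_of_likelihood_ratio {α : Type*} [MeasurableSpace α] {μ : Measure α}
    {p q : α → ℝ} {k : ℝ} {S D : Set α} (hp : Integrable p μ) (hq : Integrable q μ) (hk : 0 ≤ k)
    (hS : MeasurableSet S) (hD : MeasurableSet D)
    (h_mem : ∀ x ∈ S, k * p x ≤ q x) (h_notMem : ∀ x ∉ S, q x ≤ k * p x)
    (h_le : ∫ x in D, p x ∂μ ≤ ∫ x in S, p x ∂μ) :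
    ∫ x in D, q x ∂μ ≤ ∫ x in S, q x ∂μ := by
  have hint : Integrable (fun x => q x - k * p x) μ := hq.sub (hp.const_mul k)
  have hmain : ∫ x in D, (q x - k * p x) ∂μ ≤ ∫ x in S, (q x - k * p x) ∂μ := by
    rw [← integral_indicator hD, ← integral_indicator hS]
    refine integral_mono (hint.indicator hD) (hint.indicator hS) fun x => ?_
    by_cases hxS : x ∈ S <;> by_cases hxD : x ∈ D <;>
      simp [hxS, hxD, h_mem, h_notMem]
  have hsplit (E : Set α) :
      ∫ x in E, (q x - k * p x) ∂μ = ∫ x in E, q x ∂μ - k * ∫ x in E, p x ∂μ := by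
    rw [integral_sub hq.integrableOn (hp.const_mul k).integrableOn, integral_const_mul]
  rw [hsplit, hsplit] at hmain
  linarith [mul_le_mul_of_nonneg_left h_le hk]

theorem hasDerivAt_setIntegral_Ioi {f : ℝ → ℝ} (hf : Integrable f) (hc : Continuous f) (s : ℝ) :
    HasDerivAt (fun a => ∫ t in Set.Ioi a, f t) (-f s) s := by
  have heq : (fun a => ∫ t in Set.Ioi a, f t) =
      fun a => (∫ t in Set.Ioi s, f t) - ∫ t in s..a, f t := by
    funext a
    rw [← intervalIntegral.integral_interval_add_Ioi (hf.integrableOn (s := Set.Ioi s))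
      (hf.integrableOn (s := Set.Ioi a)), add_sub_cancel_left]
  rw [heq]
  exact (hc.integral_hasStrictDerivAt s s).hasDerivAt.const_sub _

theorem setIntegral_pos_of_forall_pos {α : Type*} [MeasurableSpace α] {μ : Measure α} {f : α → ℝ}
    {E : Set α} (hf : Integrable f μ) (hpos : ∀ x, 0 < f x) (hE : 0 < μ E) :
    0 < ∫ x in E, f x ∂μ := by
  rw [setIntegral_pos_iff_support_of_nonneg_ae (ae_of_all _ fun x => (hpos x).le) hf.integrableOn,
    Function.support_eq_univ fun x => (hpos x).ne', Set.univ_inter]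
  exact hE

theorem setIntegral_Ioi_mem_Ioo {f : ℝ → ℝ} (hf : Integrable f) (hpos : ∀ x, 0 < f x)
    (hone : ∫ x, f x = 1) (s : ℝ) : ∫ t in Set.Ioi s, f t ∈ Set.Ioo (0 : ℝ) 1 := by
  have hsum := intervalIntegral.integral_Iic_add_Ioi (b := s) hf.integrableOn hf.integrableOn
  have hIic : 0 < ∫ t in Set.Iic s, f t := setIntegral_pos_of_forall_pos hf hpos (by simp)
  exact ⟨setIntegral_pos_of_forall_pos hf hpos (by simp), by linarith⟩

/-- Main result: concavity of an SVT ROC curve is sufficient for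
Neyman-Pearson optimality.  If the SVT ROC curve `g` is strictly concave on
`(0,1)`, then for every threshold `γ` and every Lebesgue-measurable region `D`
with false-alarm probability at most `φ_F γ`, the detection probability of `D`
is at most `φ_D γ`. -/
theorem concave_svt_roc_is_neyman_pearson_optimal
    (f₀ f₁ : ℝ → ℝ)
    (hf₀_nonneg : ∀ s, 0 ≤ f₀ s) (hf₁_nonneg : ∀ s, 0 ≤ f₁ s)
    (hf₀_int : Integrable f₀) (hf₁_int : Integrable f₁)
    (hf₀_one : ∫ s, f₀ s = 1) (hf₁_one : ∫ s, f₁ s = 1)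
    (hf₀_cont : Continuous f₀) (hf₀_pos : ∀ s, 0 < f₀ s)
    (hf₁_cont : Continuous f₁)
    (g : ℝ → ℝ) (hg_diff : Differentiable ℝ g)
    (hg : ∀ s, g (∫ t in Set.Ioi s, f₀ t) = ∫ t in Set.Ioi s, f₁ t)
    (hg_concave : StrictConcaveOn ℝ (Set.Ioo 0 1) g) :
    ∀ γ : ℝ, ∀ D : Set ℝ, MeasurableSet D →
      (∫ s in D, f₀ s) ≤ (∫ s in Set.Ioi γ, f₀ s) →
      (∫ s in D, f₁ s) ≤ (∫ s in Set.Ioi γ, f₁ s) := by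
  intro γ D hD h_le
  set φ : ℝ → ℝ := fun s => ∫ t in Set.Ioi s, f₀ t
  have hφ_mem (s : ℝ) : φ s ∈ Set.Ioo (0 : ℝ) 1 :=
    setIntegral_Ioi_mem_Ioo hf₀_int hf₀_pos hf₀_one s
  have hφ_anti : Antitone φ := fun a b hab =>
    setIntegral_mono_set hf₀_int.integrableOn (ae_of_all _ hf₀_nonneg)
      (Set.Ioi_subset_Ioi hab).eventuallyLE
  have hratio (s : ℝ) : f₁ s = deriv g (φ s) * f₀ s := by
    have hcomp := (hg_diff (φ s)).hasDerivAt.comp s (hasDerivAt_setIntegral_Ioi hf₀_int hf₀_cont s)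
    rw [show g ∘ φ = fun a => ∫ t in Set.Ioi a, f₁ t from funext hg] at hcomp
    linarith [hcomp.unique (hasDerivAt_setIntegral_Ioi hf₁_int hf₁_cont s)]
  have hanti : AntitoneOn (deriv g) (Set.Ioo 0 1) :=
    hg_concave.concaveOn.antitoneOn_deriv fun x _ => hg_diff x
  have hk : 0 ≤ deriv g (φ γ) :=
    nonneg_of_mul_nonneg_left (hratio γ ▸ hf₁_nonneg γ) (hf₀_pos γ)
  refine setIntegral_le_of_likelihood_ratio hf₀_int hf₁_int hk measurableSet_Ioi hD
    (fun s hs => ?_) (fun s hs => ?_) h_le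
  · rw [hratio s]
    exact mul_le_mul_of_nonneg_right
      (hanti (hφ_mem s) (hφ_mem γ) (hφ_anti (Set.mem_Ioi.1 hs).le)) (hf₀_nonneg s)
  · rw [hratio s]
    exact mul_le_mul_of_nonneg_right
      (hanti (hφ_mem γ) (hφ_mem s) (hφ_anti (not_lt.1 hs))) (hf₀_nonneg s)
end

section
/- (Concavity is necessary for optimality of an SVT ROC curve.) Suppose f₀ is continuous and strictly positive on ℝ, f₁ is continuous, and g : ℝ → ℝ satisfies g(φ_F(s)) = φ_D(s) for all s ∈ ℝ. If every SVT is Neyman-Pearson optimal, i.e., for every γ ∈ ℝ and every Lebesgue-measurable D ⊆ ℝ, ∫_D f₀ ≤ φ_F(γ) implies ∫_D f₁ ≤ φ_D(γ), then g is concave on (0,1). -/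
open MeasureTheory

/-- The tail integrals of an integrable function differ by an interval integral. -/
lemma integral_Ioi_eq_interval_add {f : ℝ → ℝ} (hf : Integrable f) (a b : ℝ) :
    ∫ x in Set.Ioi a, f x = (∫ x in a..b, f x) + ∫ x in Set.Ioi b, f x :=
  (intervalIntegral.integral_interval_add_Ioi hf.integrableOn hf.integrableOn).symm

lemma continuous_integral_Ioi {f : ℝ → ℝ} (hf : Integrable f) :
    Continuous fun a => ∫ x in Set.Ioi a, f x := by
  have h : (fun a => ∫ x in Set.Ioi a, f x) =
      fun a => (∫ x in Set.Ioi (0 : ℝ), f x) - ∫ x in (0 : ℝ)..a, f x := by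
    funext a
    linarith [integral_Ioi_eq_interval_add hf 0 a]
  rw [h]
  exact continuous_const.sub
    (intervalIntegral.continuous_primitive (fun _ _ => hf.intervalIntegrable) 0)

/-- Every level strictly between `0` and the total integral is attained by the tail integral. -/
lemma exists_integral_Ioi_eq {f : ℝ → ℝ} (hf : Integrable f) {u : ℝ} (hu₀ : 0 < u)
    (hu₁ : u < ∫ x, f x) : ∃ a, ∫ x in Set.Ioi a, f x = u := by
  have htop : Filter.Tendsto (fun a => ∫ x in Set.Ioi a, f x) Filter.atTop (nhds 0) := by
    have h := (intervalIntegral_tendsto_integral_Ioi 0 hf.integrableOn Filter.tendsto_id).const_sub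
      (∫ x in Set.Ioi (0 : ℝ), f x)
    rw [sub_self] at h
    refine h.congr fun a => ?_
    simp only [id]
    linarith [integral_Ioi_eq_interval_add hf 0 a]
  have hbot : Filter.Tendsto (fun a => ∫ x in Set.Ioi a, f x) Filter.atBot (nhds (∫ x, f x)) := by
    have h := (intervalIntegral_tendsto_integral_Iic 0 hf.integrableOn Filter.tendsto_id).add_const
      (∫ x in Set.Ioi (0 : ℝ), f x)
    rw [intervalIntegral.integral_Iic_add_Ioi hf.integrableOn hf.integrableOn] at h
    exact h.congr fun a => (integral_Ioi_eq_interval_add hf a 0).symm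
  exact mem_range_of_exists_le_of_exists_ge (continuous_integral_Ioi hf)
    ((htop.eventually (gt_mem_nhds hu₀)).exists.imp fun _ h => le_of_lt h)
    ((hbot.eventually (lt_mem_nhds hu₁)).exists.imp fun _ h => le_of_lt h)

/-- Initial intervals at `s` of arbitrarily small prescribed mass exist. -/
lemma exists_interval_integral_eq {f : ℝ → ℝ} (hf : Integrable f) {s δ m : ℝ} (hδ : 0 < δ)
    (hm₀ : 0 < m) (hm : m ≤ ∫ x in s..s + δ, f x) :
    ∃ s', s < s' ∧ s' ≤ s + δ ∧ ∫ x in s..s', f x = m := by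
  have hc : Continuous fun b => ∫ x in s..b, f x :=
    intervalIntegral.continuous_primitive (fun _ _ => hf.intervalIntegrable) s
  obtain ⟨s', hs', h⟩ := intermediate_value_Icc (by linarith : s ≤ s + δ) hc.continuousOn
    ⟨by simpa using hm₀.le, hm⟩
  refine ⟨s', lt_of_le_of_ne hs'.1 ?_, hs'.2, h⟩
  rintro rfl
  simp only [intervalIntegral.integral_same] at h
  exact hm₀.ne h

/-- A continuous function positive at `s` is positive on some `[s, s + δ]`. -/
lemma exists_pos_on_Icc_right {h : ℝ → ℝ} (hc : Continuous h) {s : ℝ} (hs : 0 < h s) :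
    ∃ δ > 0, ∀ x ∈ Set.Icc s (s + δ), 0 < h x := by
  obtain ⟨ε, hε, hball⟩ := Metric.eventually_nhds_iff.1 (hc.continuousAt.eventually (lt_mem_nhds hs))
  refine ⟨ε / 2, by positivity, fun x hx => hball ?_⟩
  rw [Real.dist_eq, abs_lt]
  constructor <;> linarith [hx.1, hx.2]

/-- If every threshold test is Neyman-Pearson optimal then the likelihood ratio is monotone. -/
lemma monotone_likelihood_ratio_of_optimal {f₀ f₁ : ℝ → ℝ}
    (hf₀_int : Integrable f₀) (hf₁_int : Integrable f₁)
    (hf₀_cont : Continuous f₀) (hf₀_pos : ∀ s, 0 < f₀ s) (hf₁_cont : Continuous f₁)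
    (hopt : ∀ γ : ℝ, ∀ D : Set ℝ, MeasurableSet D →
      (∫ s in D, f₀ s) ≤ (∫ s in Set.Ioi γ, f₀ s) →
      (∫ s in D, f₁ s) ≤ (∫ s in Set.Ioi γ, f₁ s)) :
    Monotone fun s => f₁ s / f₀ s := by
  intro s t hst
  by_contra! hlt
  obtain ⟨l, htl, hls⟩ := exists_between hlt
  rw [div_lt_iff₀ (hf₀_pos t)] at htl
  rw [lt_div_iff₀ (hf₀_pos s)] at hls
  have hcont : Continuous fun x => l * f₀ x := continuous_const.mul hf₀_cont
  obtain ⟨δ, hδ, hs⟩ := exists_pos_on_Icc_right (hf₁_cont.sub hcont) (sub_pos.2 hls)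
  obtain ⟨ε, hε, ht⟩ := exists_pos_on_Icc_right (hcont.sub hf₁_cont) (sub_pos.2 htl)
  have hpos : ∀ a b : ℝ, 0 < b → 0 < ∫ x in a..a + b, f₀ x := fun a b hb =>
    intervalIntegral.intervalIntegral_pos_of_pos hf₀_int.intervalIntegrable hf₀_pos (by linarith)
  have hm := lt_min (hpos s δ hδ) (hpos t ε hε)
  obtain ⟨s', hss', hs'δ, hs'⟩ := exists_interval_integral_eq hf₀_int hδ hm (min_le_left _ _)
  obtain ⟨t', htt', ht'ε, ht'⟩ := exists_interval_integral_eq hf₀_int hε hm (min_le_right _ _)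
  have hD : ∀ f : ℝ → ℝ, Integrable f → ∫ x in Set.Ioc s t ∪ Set.Ioi t', f x =
      (∫ x in s..t, f x) + ∫ x in Set.Ioi t', f x := fun f hf => by
    rw [setIntegral_union _ measurableSet_Ioi hf.integrableOn hf.integrableOn,
      intervalIntegral.integral_of_le hst]
    exact Set.disjoint_left.2 fun x hx hx' => absurd hx.2 (not_le.2 (htt'.trans hx'))
  have key := hopt s' (Set.Ioc s t ∪ Set.Ioi t') (measurableSet_Ioc.union measurableSet_Ioi)
  rw [hD f₀ hf₀_int, hD f₁ hf₁_int] at key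
  have hle := key (by
    linarith [integral_Ioi_eq_interval_add hf₀_int s t, integral_Ioi_eq_interval_add hf₀_int s s',
      integral_Ioi_eq_interval_add hf₀_int t t'])
  have hi₀ := hf₀_int.const_mul l
  have h₁ := intervalIntegral.intervalIntegral_pos_of_pos_on
    (hf₁_int.sub hi₀).intervalIntegrable
    (fun x hx => hs x ⟨hx.1.le, hx.2.le.trans hs'δ⟩) hss'
  have h₂ := intervalIntegral.intervalIntegral_pos_of_pos_on
    (hi₀.sub hf₁_int).intervalIntegrable
    (fun x hx => ht x ⟨hx.1.le, hx.2.le.trans ht'ε⟩) htt'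
  simp only [Pi.sub_apply] at h₁ h₂
  rw [intervalIntegral.integral_sub hf₁_int.intervalIntegrable hi₀.intervalIntegrable,
    intervalIntegral.integral_const_mul, hs'] at h₁
  rw [intervalIntegral.integral_sub hi₀.intervalIntegrable hf₁_int.intervalIntegrable,
    intervalIntegral.integral_const_mul, ht'] at h₂
  linarith [integral_Ioi_eq_interval_add hf₁_int s t, integral_Ioi_eq_interval_add hf₁_int s s',
    integral_Ioi_eq_interval_add hf₁_int t t']

/-- A monotone likelihood ratio makes its value at `c` the slope of a supporting line of the ROC
curve at the operating point with threshold `c`. -/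
lemma integral_Ioi_sub_le_of_monotone_likelihood_ratio {f₀ f₁ : ℝ → ℝ}
    (hf₀_int : Integrable f₀) (hf₁_int : Integrable f₁) (hf₀_pos : ∀ s, 0 < f₀ s)
    (hmono : Monotone fun s => f₁ s / f₀ s) (c a : ℝ) :
    (∫ x in Set.Ioi a, f₁ x) - ∫ x in Set.Ioi c, f₁ x ≤
      f₁ c / f₀ c * ((∫ x in Set.Ioi a, f₀ x) - ∫ x in Set.Ioi c, f₀ x) := by
  have hi := hf₀_int.const_mul (f₁ c / f₀ c)
  rcases le_total a c with hac | hca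
  · have h := intervalIntegral.integral_mono_on hac hf₁_int.intervalIntegrable
      hi.intervalIntegrable fun x hx => (div_le_iff₀ (hf₀_pos x)).1 (hmono hx.2)
    rw [intervalIntegral.integral_const_mul] at h
    rw [integral_Ioi_eq_interval_add hf₀_int a c, integral_Ioi_eq_interval_add hf₁_int a c]
    simpa using h
  · have h := intervalIntegral.integral_mono_on hca hi.intervalIntegrable
      hf₁_int.intervalIntegrable fun x hx => (le_div_iff₀ (hf₀_pos x)).1 (hmono hx.1)
    rw [intervalIntegral.integral_const_mul] at h
    rw [integral_Ioi_eq_interval_add hf₀_int c a, integral_Ioi_eq_interval_add hf₁_int c a]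
    linarith

/-- Concavity is necessary for optimality of an SVT ROC curve: if every SVT is
Neyman-Pearson optimal, then the SVT ROC curve `g` is concave on `(0,1)`. -/
theorem neyman_pearson_optimal_implies_concave_svt_roc
    (f₀ f₁ : ℝ → ℝ)
    (hf₀_nonneg : ∀ s, 0 ≤ f₀ s) (hf₁_nonneg : ∀ s, 0 ≤ f₁ s)
    (hf₀_int : Integrable f₀) (hf₁_int : Integrable f₁)
    (hf₀_one : ∫ s, f₀ s = 1) (hf₁_one : ∫ s, f₁ s = 1)
    (hf₀_cont : Continuous f₀) (hf₀_pos : ∀ s, 0 < f₀ s)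
    (hf₁_cont : Continuous f₁)
    (g : ℝ → ℝ)
    (hg : ∀ s, g (∫ t in Set.Ioi s, f₀ t) = ∫ t in Set.Ioi s, f₁ t)
    (hopt : ∀ γ : ℝ, ∀ D : Set ℝ, MeasurableSet D →
      (∫ s in D, f₀ s) ≤ (∫ s in Set.Ioi γ, f₀ s) →
      (∫ s in D, f₁ s) ≤ (∫ s in Set.Ioi γ, f₁ s)) :
    ConcaveOn ℝ (Set.Ioo 0 1) g := by
  have hmono := monotone_likelihood_ratio_of_optimal hf₀_int hf₁_int hf₀_cont hf₀_pos hf₁_cont hopt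
  have hsurj : ∀ u ∈ Set.Ioo (0 : ℝ) 1, ∃ a, ∫ x in Set.Ioi a, f₀ x = u := fun u hu =>
    exists_integral_Ioi_eq hf₀_int hu.1 (hf₀_one ▸ hu.2)
  refine ⟨convex_Ioo 0 1, fun u hu v hv α β hα hβ hαβ => ?_⟩
  obtain ⟨c, hc⟩ := hsurj _ (convex_Ioo 0 1 hu hv hα hβ hαβ)
  obtain ⟨a, rfl⟩ := hsurj u hu
  obtain ⟨b, rfl⟩ := hsurj v hv
  have ha := mul_le_mul_of_nonneg_left
    (integral_Ioi_sub_le_of_monotone_likelihood_ratio hf₀_int hf₁_int hf₀_pos hmono c a) hα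
  have hb := mul_le_mul_of_nonneg_left
    (integral_Ioi_sub_le_of_monotone_likelihood_ratio hf₀_int hf₁_int hf₀_pos hmono c b) hβ
  rw [← hc, hg, hg, hg]
  obtain rfl : β = 1 - α := by linarith
  simp only [smul_eq_mul] at hc ⊢
  rw [hc] at ha hb
  linarith
end

section
/- (Correctness of the full procedure for generating the optimal ROC curve from a non-concave SVT ROC curve.) Suppose f₀ is continuous and strictly positive on ℝ, f₁ is continuous, and g : ℝ → ℝ is differentiable with g(φ_F(s)) = φ_D(s) for all s ∈ ℝ. Let η ≥ 0 and suppose the set {s ∈ ℝ : g′(φ_F(s)) ≥ η} is a finite union of pairwise disjoint closed intervals ⋃_{i ∈ I} [aᵢ, bᵢ] with aᵢ < bᵢ. Then the operating point of the likelihood ratio test with threshold η is obtained by summing the endpoint increments of these segments of the SVT ROC curve: ∫_{D_LRT(η)} f₀(s) ds = Σ_{i ∈ I} (φ_F(aᵢ) − φ_F(bᵢ)) and ∫_{D_LRT(η)} f₁(s) ds = Σ_{i ∈ I} (φ_D(aᵢ) − φ_D(bᵢ)). -/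
open MeasureTheory

/-- The integral over `(a, b]` is the increment of the upper-tail integral. -/
theorem setIntegral_Icc_eq_sub_Ioi {f : ℝ → ℝ} (hf : Integrable f) {a b : ℝ} (hab : a ≤ b) :
    ∫ s in Set.Icc a b, f s = (∫ s in Set.Ioi a, f s) - ∫ s in Set.Ioi b, f s := by
  rw [integral_Icc_eq_integral_Ioc, eq_sub_iff_add_eq, ← Set.Ioc_union_Ioi_eq_Ioi hab,
    setIntegral_union (Set.Ioc_disjoint_Ioi le_rfl) measurableSet_Ioi
      hf.integrableOn hf.integrableOn]

/-- The upper-tail integral of a continuous integrable function has derivative `-f`. -/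
theorem hasDerivAt_integral_Ioi {f : ℝ → ℝ} (hf : Integrable f) (hc : Continuous f) (s : ℝ) :
    HasDerivAt (fun x => ∫ t in Set.Ioi x, f t) (-f s) s := by
  have h : (fun x => ∫ t in Set.Ioi x, f t) =
      fun x => (∫ t in Set.Ioi s, f t) - ∫ t in s..x, f t := by
    funext x
    rw [← intervalIntegral.integral_Ioi_sub_Ioi' hf.integrableOn hf.integrableOn, sub_sub_cancel]
  rw [h]
  simpa using (hc.integral_hasStrictDerivAt s s).hasDerivAt.const_sub (∫ t in Set.Ioi s, f t)

/-- The integral over a finite disjoint union of closed intervals is the sum of the increments of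
the upper-tail integral. -/
theorem setIntegral_iUnion_Icc_eq_sum_sub_Ioi {ι : Type*} [Fintype ι] {f : ℝ → ℝ}
    (hf : Integrable f) {a b : ι → ℝ} (hab : ∀ i, a i ≤ b i)
    (hdisj : Pairwise fun i j => Disjoint (Set.Icc (a i) (b i)) (Set.Icc (a j) (b j))) :
    ∫ s in ⋃ i, Set.Icc (a i) (b i), f s =
      ∑ i, ((∫ s in Set.Ioi (a i), f s) - ∫ s in Set.Ioi (b i), f s) := by
  rw [integral_iUnion_fintype (fun i => measurableSet_Icc) hdisj fun i => hf.integrableOn]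
  exact Finset.sum_congr rfl fun i _ => setIntegral_Icc_eq_sub_Ioi hf (hab i)

/-- The slope of the SVT ROC curve at threshold `s` is the likelihood ratio at `s`. -/
theorem deriv_roc_mul_eq {f₀ f₁ g : ℝ → ℝ} (hf₀_int : Integrable f₀) (hf₁_int : Integrable f₁)
    (hf₀_cont : Continuous f₀) (hf₁_cont : Continuous f₁) (hg_diff : Differentiable ℝ g)
    (hg : ∀ s, g (∫ t in Set.Ioi s, f₀ t) = ∫ t in Set.Ioi s, f₁ t) (s : ℝ) :
    deriv g (∫ t in Set.Ioi s, f₀ t) * f₀ s = f₁ s := by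
  have h := (hg_diff _).hasDerivAt.comp s (hasDerivAt_integral_Ioi hf₀_int hf₀_cont s)
  have h' : (g ∘ fun x => ∫ t in Set.Ioi x, f₀ t) = fun x => ∫ t in Set.Ioi x, f₁ t := funext hg
  rw [h'] at h
  have := h.unique (hasDerivAt_integral_Ioi hf₁_int hf₁_cont s)
  linarith



/-- Correctness of the full procedure for generating the optimal ROC curve
from a non-concave SVT ROC curve: if the set of scores where the slope of the
SVT ROC curve is at least `η` is a finite union of pairwise disjoint closed
intervals `[aᵢ, bᵢ]`, then the LRT operating point at threshold `η` is
obtained by summing the endpoint increments of these segments. -/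
theorem optimal_roc_from_svt_roc_procedure
    (f₀ f₁ : ℝ → ℝ)
    (hf₀_nonneg : ∀ s, 0 ≤ f₀ s) (hf₁_nonneg : ∀ s, 0 ≤ f₁ s)
    (hf₀_int : Integrable f₀) (hf₁_int : Integrable f₁)
    (hf₀_one : ∫ s, f₀ s = 1) (hf₁_one : ∫ s, f₁ s = 1)
    (hf₀_cont : Continuous f₀) (hf₀_pos : ∀ s, 0 < f₀ s)
    (hf₁_cont : Continuous f₁)
    (g : ℝ → ℝ) (hg_diff : Differentiable ℝ g)
    (hg : ∀ s, g (∫ t in Set.Ioi s, f₀ t) = ∫ t in Set.Ioi s, f₁ t)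
    (η : ℝ) (hη : 0 ≤ η)
    (ι : Type) [Fintype ι] (a b : ι → ℝ)
    (hab : ∀ i, a i < b i)
    (hdisj : Pairwise fun i j =>
      Disjoint (Set.Icc (a i) (b i)) (Set.Icc (a j) (b j)))
    (hunion : {s : ℝ | η ≤ deriv g (∫ t in Set.Ioi s, f₀ t)} =
      ⋃ i, Set.Icc (a i) (b i)) :
    (∫ s in {s : ℝ | η * f₀ s ≤ f₁ s}, f₀ s) =
      ∑ i, ((∫ s in Set.Ioi (a i), f₀ s) - ∫ s in Set.Ioi (b i), f₀ s) ∧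
    (∫ s in {s : ℝ | η * f₀ s ≤ f₁ s}, f₁ s) =
      ∑ i, ((∫ s in Set.Ioi (a i), f₁ s) - ∫ s in Set.Ioi (b i), f₁ s) := by
  have hset : {s : ℝ | η * f₀ s ≤ f₁ s} = ⋃ i, Set.Icc (a i) (b i) := by
    rw [← hunion]
    ext s
    rw [Set.mem_ofPred_eq, Set.mem_ofPred_eq,
      ← deriv_roc_mul_eq hf₀_int hf₁_int hf₀_cont hf₁_cont hg_diff hg s,
      mul_le_mul_iff_left₀ (hf₀_pos s)]
  rw [hset]
  exact ⟨setIntegral_iUnion_Icc_eq_sum_sub_Ioi hf₀_int (fun i => (hab i).le) hdisj,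
    setIntegral_iUnion_Icc_eq_sum_sub_Ioi hf₁_int (fun i => (hab i).le) hdisj⟩
end

section
/- (Uniqueness of the Neyman-Pearson optimal region.) Let η ≥ 0 and suppose the level set {s ∈ ℝ : f₁(s) = η·f₀(s)} has Lebesgue measure zero. If D ⊆ ℝ is Lebesgue-measurable with ∫_D f₀ ≤ ∫_{D_LRT(η)} f₀ and ∫_D f₁ ≥ ∫_{D_LRT(η)} f₁, then the symmetric difference D Δ D_LRT(η) has Lebesgue measure zero. -/
open MeasureTheory symmDiff

/-- An integrable function without zeros (up to a null set) has its superlevel set `{0 ≤ g}` as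
its only maximizer, up to a null set, of the set integral. -/
theorem measure_symmDiff_nonneg_eq_zero {α : Type*} [MeasurableSpace α] {μ : Measure α}
    {g : α → ℝ} (hg : Measurable g) (hg_int : Integrable g μ) (hzero : μ {x | g x = 0} = 0)
    {D : Set α} (hD : MeasurableSet D)
    (hle : ∫ x in {x | 0 ≤ g x}, g x ∂μ ≤ ∫ x in D, g x ∂μ) :
    μ (D ∆ {x | 0 ≤ g x}) = 0 := by
  have hL : MeasurableSet {x | 0 ≤ g x} := measurableSet_le measurable_const hg
  have hL_int := hg_int.indicator hL
  have hD_int := hg_int.indicator hD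
  have hind : D.indicator g ≤ {x | 0 ≤ g x}.indicator g := by
    intro x
    by_cases hx : x ∈ D <;> by_cases hgx : 0 ≤ g x <;> simp [hx, hgx]
    exact (not_le.mp hgx).le
  have heq : D.indicator g =ᵐ[μ] {x | 0 ≤ g x}.indicator g := by
    refine (integral_eq_iff_of_ae_le hD_int hL_int (.of_forall hind)).mp
      (le_antisymm (integral_mono hD_int hL_int hind) ?_)
    rwa [integral_indicator hL, integral_indicator hD]
  have hne : ∀ᵐ x ∂μ, g x ≠ 0 := by simpa [ae_iff] using hzero
  rw [measure_symmDiff_eq_zero_iff]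
  filter_upwards [heq, hne] with x hx hgx
  refine propext ?_
  change x ∈ D ↔ 0 ≤ g x
  by_cases hxD : x ∈ D <;> by_cases hxL : 0 ≤ g x <;>
    simp_all [Set.indicator]

/-- Uniqueness of the Neyman-Pearson optimal region: if the level set
`{s : f₁ s = η·f₀ s}` has Lebesgue measure zero and a measurable region `D`
does at least as well as `D_LRT(η)` (no larger false-alarm probability, no
smaller detection probability), then `D` agrees with `D_LRT(η)` up to a set of
Lebesgue measure zero. -/
theorem neyman_pearson_optimal_region_unique
    (f₀ f₁ : ℝ → ℝ)
    (hf₀_nonneg : ∀ s, 0 ≤ f₀ s) (hf₁_nonneg : ∀ s, 0 ≤ f₁ s)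
    (hf₀_int : Integrable f₀) (hf₁_int : Integrable f₁)
    (hf₀_one : ∫ s, f₀ s = 1) (hf₁_one : ∫ s, f₁ s = 1)
    (hf₀_cont : Continuous f₀) (hf₁_cont : Continuous f₁)
    (η : ℝ) (hη : 0 ≤ η)
    (hlevel : volume {s : ℝ | f₁ s = η * f₀ s} = 0)
    (D : Set ℝ) (hD : MeasurableSet D)
    (hPF : (∫ s in D, f₀ s) ≤ ∫ s in {s : ℝ | η * f₀ s ≤ f₁ s}, f₀ s)
    (hPD : (∫ s in {s : ℝ | η * f₀ s ≤ f₁ s}, f₁ s) ≤ ∫ s in D, f₁ s) :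
    volume (D ∆ {s : ℝ | η * f₀ s ≤ f₁ s}) = 0 := by
  have hregion : {s : ℝ | η * f₀ s ≤ f₁ s} = {s | 0 ≤ f₁ s - η * f₀ s} := by
    simp only [sub_nonneg]
  have hsub (S : Set ℝ) :
      ∫ s in S, (f₁ s - η * f₀ s) = (∫ s in S, f₁ s) - η * ∫ s in S, f₀ s := by
    rw [integral_sub hf₁_int.restrict (hf₀_int.restrict.const_mul η), integral_const_mul]
  rw [hregion] at hPF hPD ⊢
  refine measure_symmDiff_nonneg_eq_zero (g := fun s => f₁ s - η * f₀ s)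
    (hf₁_cont.sub (hf₀_cont.const_mul η)).measurable
    (hf₁_int.sub (hf₀_int.const_mul η)) (by simpa only [sub_eq_zero] using hlevel) hD ?_
  rw [hsub, hsub]
  exact sub_le_sub hPD (mul_le_mul_of_nonneg_left hPF hη)
end

section
/- (Concavity of the LRT ROC curve via supporting lines; the necessary condition for optimality.) For all η, η′ ≥ 0, the LRT operating point at threshold η′ lies on or below the line of slope η through the LRT operating point at threshold η: ∫_{D_LRT(η′)} f₁(s) ds ≤ ∫_{D_LRT(η)} f₁(s) ds + η·(∫_{D_LRT(η′)} f₀(s) ds − ∫_{D_LRT(η)} f₀(s) ds). -/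
open MeasureTheory

/-- Concavity of the LRT ROC curve via supporting lines: for all thresholds
`η, η′ ≥ 0`, the LRT operating point at `η′` lies on or below the line of
slope `η` through the LRT operating point at `η`. -/
theorem lrt_roc_supporting_line
    (f₀ f₁ : ℝ → ℝ)
    (hf₀_nonneg : ∀ s, 0 ≤ f₀ s) (hf₁_nonneg : ∀ s, 0 ≤ f₁ s)
    (hf₀_int : Integrable f₀) (hf₁_int : Integrable f₁)
    (hf₀_one : ∫ s, f₀ s = 1) (hf₁_one : ∫ s, f₁ s = 1)
    (hf₀_cont : Continuous f₀) (hf₁_cont : Continuous f₁)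
    (η η' : ℝ) (hη : 0 ≤ η) (hη' : 0 ≤ η') :
    (∫ s in {s : ℝ | η' * f₀ s ≤ f₁ s}, f₁ s) ≤
      (∫ s in {s : ℝ | η * f₀ s ≤ f₁ s}, f₁ s) +
        η * ((∫ s in {s : ℝ | η' * f₀ s ≤ f₁ s}, f₀ s) -
          ∫ s in {s : ℝ | η * f₀ s ≤ f₁ s}, f₀ s) := by
  have hg : Integrable fun s => f₁ s - η * f₀ s := hf₁_int.sub (hf₀_int.const_mul η)
  have hg_cont : Continuous fun s => f₁ s - η * f₀ s := by fun_prop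
  have hmeas : MeasurableSet {s : ℝ | η' * f₀ s ≤ f₁ s} :=
    (isClosed_le (by fun_prop) hf₁_cont).measurableSet
  have hsplit (S : Set ℝ) :
      ∫ s in S, (f₁ s - η * f₀ s) = (∫ s in S, f₁ s) - η * ∫ s in S, f₀ s := by
    rw [integral_sub hf₁_int.integrableOn (hf₀_int.const_mul η).integrableOn,
      integral_const_mul]
  have hle := setIntegral_le_nonneg hmeas hg_cont.stronglyMeasurable hg
  simp only [sub_nonneg, hsplit] at hle
  linarith
end

section
/- (The LRT ROC curve has no linear regions: strict concavity between distinct operating points.) Let η, η′ ≥ 0 and suppose the level set {s ∈ ℝ : f₁(s) = η·f₀(s)} has Lebesgue measure zero and the symmetric difference D_LRT(η′) Δ D_LRT(η) has positive Lebesgue measure. Then the supporting-line inequality is strict: ∫_{D_LRT(η′)} f₁(s) ds < ∫_{D_LRT(η)} f₁(s) ds + η·(∫_{D_LRT(η′)} f₀(s) ds − ∫_{D_LRT(η)} f₀(s) ds). -/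
open MeasureTheory symmDiff

/-- Among all measurable sets, `{x | 0 ≤ g x}` is the unique maximizer of `T ↦ ∫ x in T, g x ∂μ`
up to null sets, provided `g` vanishes only on a null set. -/
theorem setIntegral_lt_setIntegral_nonneg {α : Type*} [MeasurableSpace α] {μ : Measure α}
    {g : α → ℝ} (hg : Measurable g) (hgi : Integrable g μ) {T : Set α} (hT : MeasurableSet T)
    (hzero : μ {x | g x = 0} = 0) (hdiff : 0 < μ (T ∆ {x | 0 ≤ g x})) :
    ∫ x in T, g x ∂μ < ∫ x in {x | 0 ≤ g x}, g x ∂μ := by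
  have hS : MeasurableSet {x | 0 ≤ g x} := measurableSet_le measurable_const hg
  rw [← integral_indicator hT, ← integral_indicator hS, ← sub_pos,
    ← integral_sub (hgi.indicator hS) (hgi.indicator hT)]
  refine (integral_pos_iff_support_of_nonneg ?_
    ((hgi.indicator hS).sub (hgi.indicator hT))).2 ?_
  rotate_left
  · rw [← measure_sdiff_null hzero] at hdiff
    refine hdiff.trans_le (measure_mono ?_)
    rintro x ⟨hx, hx0⟩
    by_cases hxT : x ∈ T <;> by_cases hxS : 0 ≤ g x <;>
      simp_all [Set.mem_symmDiff, Set.indicator, not_le.2]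
  · intro x
    by_cases hxT : x ∈ T <;> by_cases hxS : 0 ≤ g x <;>
      simp [Set.indicator, hxT, hxS, le_of_not_ge]

/-- The LRT ROC curve has no linear regions: if the level set
`{s : f₁ s = η·f₀ s}` has Lebesgue measure zero and the regions `D_LRT(η′)`
and `D_LRT(η)` differ on a set of positive Lebesgue measure, then the
supporting-line inequality is strict. -/
theorem lrt_roc_strict_supporting_line
    (f₀ f₁ : ℝ → ℝ)
    (hf₀_nonneg : ∀ s, 0 ≤ f₀ s) (hf₁_nonneg : ∀ s, 0 ≤ f₁ s)
    (hf₀_int : Integrable f₀) (hf₁_int : Integrable f₁)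
    (hf₀_one : ∫ s, f₀ s = 1) (hf₁_one : ∫ s, f₁ s = 1)
    (hf₀_cont : Continuous f₀) (hf₁_cont : Continuous f₁)
    (η η' : ℝ) (hη : 0 ≤ η) (hη' : 0 ≤ η')
    (hlevel : volume {s : ℝ | f₁ s = η * f₀ s} = 0)
    (hdiff : 0 < volume ({s : ℝ | η' * f₀ s ≤ f₁ s} ∆ {s : ℝ | η * f₀ s ≤ f₁ s})) :
    (∫ s in {s : ℝ | η' * f₀ s ≤ f₁ s}, f₁ s) <
      (∫ s in {s : ℝ | η * f₀ s ≤ f₁ s}, f₁ s) +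
        η * ((∫ s in {s : ℝ | η' * f₀ s ≤ f₁ s}, f₀ s) -
          ∫ s in {s : ℝ | η * f₀ s ≤ f₁ s}, f₀ s) := by
  have hgi : Integrable (fun s => f₁ s - η * f₀ s) := hf₁_int.sub (hf₀_int.const_mul η)
  have hT : MeasurableSet {s : ℝ | η' * f₀ s ≤ f₁ s} :=
    measurableSet_le (by fun_prop) (by fun_prop)
  have key := setIntegral_lt_setIntegral_nonneg (g := fun s => f₁ s - η * f₀ s)
    (by fun_prop) hgi hT (by simpa only [sub_eq_zero] using hlevel)
    (by simpa only [sub_nonneg] using hdiff)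
  simp only [sub_nonneg] at key
  have hsplit (A : Set ℝ) : ∫ s in A, (f₁ s - η * f₀ s) =
      (∫ s in A, f₁ s) - η * ∫ s in A, f₀ s := by
    rw [integral_sub hf₁_int.integrableOn (hf₀_int.const_mul η).integrableOn,
      integral_const_mul]
  rw [hsplit, hsplit] at key
  linarith
end
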